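/- Let n ≥ 1, let f : ℝⁿ → ℝ be twice continuously differentiable, and let U ⊆ ℝⁿ be an open convex set on which ∇²f is Lipschitz continuous with constant L > 0. Let η > 0, x ∈ U, s ∈ ℝⁿ with s ≠ 0 and x + s ∈ U, δ > 0, and λ ∈ ℝ. Suppose, with r = ∇f(x) + (∇²f(x) + λI)s, that rᵀs ≤ 0, sᵀ(∇²f(x) + λI)s ≥ 0, λ ≥ 0, ‖s‖ ≤ δ, and λ(δ − ‖s‖) = 0. If λ ≥ (L + 2η)‖s‖, then ‖s‖ = δ and (f(x) − f(x + s)) / ‖s‖³ ≥ η. -/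

import Mathlib

open RealInnerProductSpace

/-- First-order Taylor bound for a map whose derivative is Lipschitz around `x` on a convex set. -/
theorem norm_sub_sub_fderiv_le_of_lipschitz
    {E F : Type*} [NormedAddCommGroup E] [NormedSpace ℝ E] [NormedAddCommGroup F]
    [NormedSpace ℝ F]
    {g : E → F} (hg : Differentiable ℝ g) {U : Set E} (hU : Convex ℝ U) {L : ℝ} (hL : 0 ≤ L)
    {x s : E} (hx : x ∈ U) (hxs : x + s ∈ U)
    (hLip : ∀ y ∈ U, ‖fderiv ℝ g y - fderiv ℝ g x‖ ≤ L * ‖y - x‖) :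
    ‖g (x + s) - g x - fderiv ℝ g x s‖ ≤ L * ‖s‖ ^ 2 := by
  have key := (hU.inter (convex_closedBall x ‖s‖)).norm_image_sub_le_of_norm_fderiv_le'
    (𝕜 := ℝ) (f := g) (φ := fderiv ℝ g x) (C := L * ‖s‖) (x := x) (y := x + s)
    (fun y _ => hg y)
    (fun y hy => (hLip y hy.1).trans
      (mul_le_mul_of_nonneg_left (mem_closedBall_iff_norm.1 hy.2) hL))
    ⟨hx, by simp⟩ ⟨hxs, by simp⟩
  rw [add_sub_cancel_left] at key
  linarith

section TaylorBound

variable {E : Type*} [NormedAddCommGroup E] [InnerProductSpace ℝ E] [CompleteSpace E]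

theorem ContDiff.differentiable_gradient {f : E → ℝ} (hf : ContDiff ℝ 2 f) :
    Differentiable ℝ (gradient f) :=
  (InnerProductSpace.toDual ℝ E).symm.toContinuousLinearEquiv.differentiable.comp
    ((hf.fderiv_right (m := 1) (by norm_num)).differentiable (by norm_num))

/-- Second-order Taylor upper bound for a function with Lipschitz Hessian. -/
theorem le_taylor_two_add_of_lipschitz_hessian {f : E → ℝ} (hf : ContDiff ℝ 2 f) {U : Set E}
    (hU : Convex ℝ U) {L : ℝ} (hL : 0 ≤ L) {x s : E} (hx : x ∈ U) (hxs : x + s ∈ U)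
    (hLip : ∀ y ∈ U,
      ‖fderiv ℝ (gradient f) y - fderiv ℝ (gradient f) x‖ ≤ L * ‖y - x‖) :
    f (x + s) ≤ f x + ⟪gradient f x, s⟫ + ⟪fderiv ℝ (gradient f) x s, s⟫ / 2
      + L / 2 * ‖s‖ ^ 3 := by
  set c := ⟪gradient f x, s⟫ with hc
  set q := ⟪fderiv ℝ (gradient f) x s, s⟫ with hq
  have hderiv (t : ℝ) : HasDerivAt
      (fun t : ℝ => f (x + t • s) - t * c - t ^ 2 * ((q + L * ‖s‖ ^ 3) / 2))
      (⟪gradient f (x + t • s), s⟫ - c - t * (q + L * ‖s‖ ^ 3)) t := by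
    have hline : HasDerivAt (fun t : ℝ => x + t • s) s t := by
      simpa using ((hasDerivAt_id t).smul_const s).const_add x
    have hf' := ((hf.differentiable (by norm_num)) (x + t • s)).hasGradientAt.hasFDerivAt
    have hcomp := hf'.comp_hasDerivAt t hline
    rw [InnerProductSpace.toDual_apply_apply] at hcomp
    refine ((hcomp.sub ((hasDerivAt_id t).mul_const c)).sub
      ((hasDerivAt_pow 2 t).mul_const ((q + L * ‖s‖ ^ 3) / 2))).congr_deriv ?_
    push_cast
    ring
  have hanti : AntitoneOn
      (fun t : ℝ => f (x + t • s) - t * c - t ^ 2 * ((q + L * ‖s‖ ^ 3) / 2))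
      (Set.Icc 0 1) := by
    refine antitoneOn_of_hasDerivWithinAt_nonpos (convex_Icc 0 1)
      (fun t _ => (hderiv t).continuousAt.continuousWithinAt)
      (fun t _ => (hderiv t).hasDerivWithinAt) fun t ht => ?_
    obtain ⟨ht0, ht1⟩ := interior_subset ht
    have hbound := norm_sub_sub_fderiv_le_of_lipschitz hf.differentiable_gradient hU hL hx
      (hU.add_smul_mem hx hxs ⟨ht0, ht1⟩) hLip
    have hinner := (real_inner_le_norm
      (gradient f (x + t • s) - gradient f x - fderiv ℝ (gradient f) x (t • s)) s).trans
      (mul_le_mul_of_nonneg_right hbound (norm_nonneg s))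
    rw [inner_sub_left, inner_sub_left, map_smul, real_inner_smul_left, ← hc, ← hq, norm_smul,
      Real.norm_of_nonneg ht0] at hinner
    have hsq : t ^ 2 * (L * ‖s‖ ^ 3) ≤ t * (L * ‖s‖ ^ 3) :=
      mul_le_mul_of_nonneg_right (by nlinarith) (by positivity)
    linarith
  have h01 := hanti (Set.left_mem_Icc.2 zero_le_one) (Set.right_mem_Icc.2 zero_le_one) zero_le_one
  simp only [one_smul, zero_smul, add_zero] at h01
  linarith

end TaylorBound

/-- Suppose `f` is twice continuously differentiable with `L`-Lipschitz
Hessian on an open convex set `U`, and `(s, λ)` with residual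
`r = ∇f(x) + (∇²f(x) + λI)s` satisfies the inexact trust-region termination conditions
`rᵀs ≤ 0`, `sᵀ(∇²f(x) + λI)s ≥ 0`, `λ ≥ 0`, `‖s‖ ≤ δ`, `λ(δ − ‖s‖) = 0`.
If `λ ≥ (L + 2η)‖s‖`, then `‖s‖ = δ` and `(f(x) − f(x+s))/‖s‖³ ≥ η`. -/
theorem stmt_5 {n : ℕ} (hn : 1 ≤ n)
    (f : EuclideanSpace ℝ (Fin n) → ℝ) (hf : ContDiff ℝ 2 f)
    (U : Set (EuclideanSpace ℝ (Fin n))) (hUopen : IsOpen U) (hUconv : Convex ℝ U)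
    (L : ℝ) (hL : 0 < L)
    (hLip : ∀ y ∈ U, ∀ z ∈ U,
      ‖fderiv ℝ (gradient f) y - fderiv ℝ (gradient f) z‖ ≤ L * ‖y - z‖)
    (η : ℝ) (hη : 0 < η)
    (x : EuclideanSpace ℝ (Fin n)) (hx : x ∈ U)
    (s : EuclideanSpace ℝ (Fin n)) (hs : s ≠ 0) (hxs : x + s ∈ U)
    (δ : ℝ) (hδ : 0 < δ) (lam : ℝ)
    (r : EuclideanSpace ℝ (Fin n))
    (hr : r = gradient f x + (fderiv ℝ (gradient f) x) s + lam • s)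
    (h1 : ⟪r, s⟫ ≤ 0)
    (h2 : 0 ≤ ⟪(fderiv ℝ (gradient f) x) s + lam • s, s⟫)
    (h3 : 0 ≤ lam) (h4 : ‖s‖ ≤ δ) (h5 : lam * (δ - ‖s‖) = 0)
    (hlam : (L + 2 * η) * ‖s‖ ≤ lam) :
    ‖s‖ = δ ∧ η ≤ (f x - f (x + s)) / ‖s‖ ^ 3 := by
  have hspos : 0 < ‖s‖ := norm_pos_iff.2 hs
  have hlampos : 0 < lam := lt_of_lt_of_le (by positivity) hlam
  refine ⟨?_, ?_⟩
  · rcases mul_eq_zero.1 h5 with h | h <;> linarith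
  · have htaylor := le_taylor_two_add_of_lipschitz_hessian hf hUconv hL.le hx hxs
      fun y hy => hLip y hy x hx
    rw [hr, inner_add_left, inner_add_left, real_inner_smul_left,
      real_inner_self_eq_norm_sq] at h1
    rw [inner_add_left, real_inner_smul_left, real_inner_self_eq_norm_sq] at h2
    have hmul := mul_le_mul_of_nonneg_right hlam (sq_nonneg ‖s‖)
    rw [le_div_iff₀ (by positivity)]
    linarith
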